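/- arXiv:1302.2324 — 2 statements merged into one kernel-verified Lean document; each statement's English description precedes it below -/
import Mathlib

section
/- Any two nonempty totally disconnected perfect compact metric spaces are homeomorphic. -/
open Set TopologicalSpace

namespace CantorSpace

/-- The cell containing `x` after `n` refinements: starting from the whole space, the cell `A`
obtained after `n` steps is cut along the clopen set `D n A`. -/
noncomputable def cell {X : Type*} [TopologicalSpace X] (D : ℕ → Clopens X → Clopens X) (x : X) :
    ℕ → Clopens X
  | 0 => ⊤
  | n + 1 => open Classical in
    if x ∈ D n (cell D x n) then cell D x n ⊓ D n (cell D x n)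
    else cell D x n \ D n (cell D x n)

/-- The itinerary of `x` records on which side of each successive cut `x` lies. -/
noncomputable def itinerary {X : Type*} [TopologicalSpace X] (D : ℕ → Clopens X → Clopens X)
    (x : X) (n : ℕ) : Bool :=
  open Classical in decide (x ∈ D n (cell D x n))

section Cell

variable {X : Type*} [TopologicalSpace X] (D : ℕ → Clopens X → Clopens X)

theorem mem_cell_succ {x y : X} {n : ℕ} :
    y ∈ cell D x (n + 1) ↔
      y ∈ cell D x n ∧ (y ∈ D n (cell D x n) ↔ x ∈ D n (cell D x n)) := by
  rw [cell]
  split_ifs with h <;> simp [← SetLike.mem_coe] at h ⊢ <;> simp [h]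

theorem mem_cell_self (x : X) (n : ℕ) : x ∈ cell D x n := by
  induction n with
  | zero => exact mem_univ x
  | succ n ih => exact (mem_cell_succ D).2 ⟨ih, Iff.rfl⟩

theorem cell_eq_of_mem {x y : X} {n : ℕ} (h : y ∈ cell D x n) : cell D y n = cell D x n := by
  induction n with
  | zero => rfl
  | succ n ih =>
    obtain ⟨h₁, h₂⟩ := (mem_cell_succ D).1 h
    rw [cell, cell, ih h₁]
    classical exact if_congr h₂ rfl rfl

theorem mem_cell_iff_itinerary_eq {x y : X} {n : ℕ} :
    y ∈ cell D x n ↔ ∀ i < n, itinerary D y i = itinerary D x i := by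
  induction n with
  | zero => exact iff_of_true (mem_univ y) (by simp)
  | succ n ih =>
    rw [Nat.forall_lt_succ_right, ← ih, mem_cell_succ]
    refine and_congr_right fun h => ?_
    rw [itinerary, itinerary, cell_eq_of_mem D h, decide_eq_decide]

theorem continuous_itinerary : Continuous (itinerary D) := by
  refine continuous_pi fun n => IsLocallyConstant.continuous ?_
  rw [IsLocallyConstant.iff_exists_open]
  exact fun x => ⟨cell D x (n + 1), (cell D x (n + 1)).isOpen, mem_cell_self D x _,
    fun y hy => (mem_cell_iff_itinerary_eq D).1 hy n n.lt_succ_self⟩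

theorem denseRange_itinerary [Nonempty X]
    (hD : ∀ n (A : Clopens X), (A : Set X).Nonempty →
      (∃ x ∈ A, x ∈ D n A) ∧ ∃ x ∈ A, x ∉ D n A) :
    DenseRange (itinerary D) := by
  have approx (s : ℕ → Bool) (n : ℕ) : ∃ x, ∀ i < n, itinerary D x i = s i := by
    induction n with
    | zero => simp
    | succ n ih =>
      obtain ⟨x, hx⟩ := ih
      obtain ⟨y, hy, hs⟩ : ∃ y ∈ cell D x n, itinerary D y n = s n := by
        obtain ⟨⟨y, hy, hyD⟩, z, hz, hzD⟩ := hD n (cell D x n) ⟨x, mem_cell_self D x n⟩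
        cases s n
        · exact ⟨z, hz, by simpa [itinerary, cell_eq_of_mem D hz] using hzD⟩
        · exact ⟨y, hy, by simpa [itinerary, cell_eq_of_mem D hy] using hyD⟩
      refine ⟨y, Nat.forall_lt_succ_right.2 ⟨fun i hi => ?_, hs⟩⟩
      rw [(mem_cell_iff_itinerary_eq D).1 hy i hi, hx i hi]
  choose u hu using approx
  refine fun s => mem_closure_of_tendsto (f := fun n => itinerary D (u s n))
    (b := Filter.atTop) ?_ (.of_forall fun n => mem_range_self _)
  refine tendsto_pi_nhds.2 fun i => tendsto_nhds_of_eventually_eq ?_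
  filter_upwards [Filter.eventually_gt_atTop i] with n hn using hu s n i hn

end Cell

theorem exists_clopen_cut {X : Type*} [TopologicalSpace X] [TotallySeparatedSpace X]
    [PerfectSpace X] (C A : Clopens X) (hA : (A : Set X).Nonempty) :
    ∃ D : Clopens X, ((∃ x ∈ A, x ∈ D) ∧ ∃ x ∈ A, x ∉ D) ∧
      ∀ x ∈ A, ∀ y ∈ A, (x ∈ D ↔ y ∈ D) → (x ∈ C ↔ y ∈ C) := by
  by_cases h : (∃ x ∈ A, x ∈ C) ∧ ∃ x ∈ A, x ∉ C
  · exact ⟨C, h, fun _ _ _ _ => id⟩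
  · obtain ⟨x, hx⟩ := hA
    obtain ⟨y, ⟨hy, -⟩, hyx⟩ := preperfect_iff_nhds.1 PerfectSpace.univ_preperfect x (mem_univ x)
      A (A.isOpen.mem_nhds hx)
    obtain ⟨U, hU, hyU, hxU⟩ := exists_isClopen_of_totally_separated hyx
    refine ⟨⟨U, hU⟩, ⟨⟨y, hy, hyU⟩, x, hx, hxU⟩, fun a ha b hb _ => ?_⟩
    by_contra hab
    apply h
    by_cases haC : a ∈ C
    · exact ⟨⟨a, ha, haC⟩, b, hb, fun hbC => hab (iff_of_true haC hbC)⟩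
    · exact ⟨⟨b, hb, by_contra fun hbC => hab (iff_of_false haC hbC)⟩, a, ha, haC⟩

/-- **Brouwer's theorem**: a nonempty totally disconnected perfect compact Hausdorff space with a
countable base is homeomorphic to the Cantor space. -/
theorem nonempty_homeomorph (X : Type*) [TopologicalSpace X] [T2Space X]
    [SecondCountableTopology X] [Nonempty X] [CompactSpace X] [TotallyDisconnectedSpace X]
    [PerfectSpace X] : Nonempty (X ≃ₜ (ℕ → Bool)) := by
  have : Countable (Clopens X) := Clopens.countable_iff_secondCountable.2 inferInstance
  obtain ⟨C, hC⟩ := exists_surjective_nat (Clopens X)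
  have cut (n : ℕ) (A : Clopens X) : ∃ D : Clopens X, (A : Set X).Nonempty →
      ((∃ x ∈ A, x ∈ D) ∧ ∃ x ∈ A, x ∉ D) ∧
        ∀ x ∈ A, ∀ y ∈ A, (x ∈ D ↔ y ∈ D) → (x ∈ C n ↔ y ∈ C n) := by
    by_cases hA : (A : Set X).Nonempty
    · exact (exists_clopen_cut (C n) A hA).imp fun _ h _ => h
    · exact ⟨⊥, fun h => absurd h hA⟩
  choose D hD using cut
  have hcont := continuous_itinerary D
  have hinj : Function.Injective (itinerary D) := by
    intro x y hxy
    by_contra hne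
    obtain ⟨U, hU, hxU, hyU⟩ := exists_isClopen_of_totally_separated hne
    obtain ⟨n, hn⟩ := hC ⟨U, hU⟩
    have hx : x ∈ cell D y (n + 1) := (mem_cell_iff_itinerary_eq D).2 fun i _ => congrFun hxy i
    obtain ⟨hx, hxD⟩ := (mem_cell_succ D).1 hx
    have := (hD n _ ⟨x, hx⟩).2 x hx y (mem_cell_self D y n) hxD
    rw [hn] at this
    exact hyU (this.1 hxU)
  have hsurj : Function.Surjective (itinerary D) := by
    rw [← range_eq_univ, ← (isCompact_range hcont).isClosed.closure_eq]
    exact (denseRange_itinerary D fun n A hA => (hD n A hA).1).closure_range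
  exact ⟨hcont.homeoOfEquivCompactToT2 (f := Equiv.ofBijective _ ⟨hinj, hsurj⟩)⟩

end CantorSpace

/-- Any two nonempty totally disconnected perfect compact metric spaces are homeomorphic. -/
theorem homeomorph_of_totallyDisconnected_perfect_compact_metric
    (X Y : Type*) [MetricSpace X] [MetricSpace Y]
    [Nonempty X] [Nonempty Y] [CompactSpace X] [CompactSpace Y]
    [TotallyDisconnectedSpace X] [TotallyDisconnectedSpace Y]
    [PerfectSpace X] [PerfectSpace Y] :
    Nonempty (X ≃ₜ Y) := by
  obtain ⟨e⟩ := CantorSpace.nonempty_homeomorph X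
  obtain ⟨f⟩ := CantorSpace.nonempty_homeomorph Y
  exact ⟨e.trans f.symm⟩
end

section
/- Let M be a nonempty compact, totally disconnected metric (equivalently metrizable) space. Then M is homeomorphic to the inverse limit space of an inverse limit sequence of finite discrete spaces. -/
/-- A compact, second countable, totally separated space injects continuously into the
Cantor space. -/
theorem exists_continuous_injective_nat_bool (X : Type*) [TopologicalSpace X] [CompactSpace X]
    [SecondCountableTopology X] [TotallySeparatedSpace X] :
    ∃ e : X → ℕ → Bool, Continuous e ∧ Function.Injective e := by
  have : Countable (TopologicalSpace.Clopens X) :=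
    TopologicalSpace.Clopens.countable_iff_secondCountable.mpr inferInstance
  obtain ⟨c, hc⟩ := exists_surjective_nat (TopologicalSpace.Clopens X)
  refine ⟨fun x n => (c n : Set X).boolIndicator x, ?_, ?_⟩
  · exact continuous_pi fun n => (continuous_boolIndicator_iff_isClopen _).2 (c n).isClopen
  · intro x y hxy
    by_contra hne
    obtain ⟨U, hU, hxU, hyU⟩ := exists_isClopen_of_totally_separated hne
    obtain ⟨n, hn⟩ := hc ⟨U, hU⟩
    have h := congrFun hxy n
    simp only [hn] at h
    exact hyU ((Set.mem_iff_boolIndicator U y).2 (h ▸ (Set.mem_iff_boolIndicator U x).1 hxU))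

/-- Every nonempty compact totally disconnected metric space is homeomorphic to the
inverse limit space of an inverse limit sequence of finite discrete spaces. -/
theorem homeomorph_inverseLimit_of_compact_totallyDisconnected_metric
    (M : Type*) [MetricSpace M] [Nonempty M] [CompactSpace M]
    [TotallyDisconnectedSpace M] :
    ∃ (Y : ℕ → Type) (_ : ∀ n, TopologicalSpace (Y n)) (_ : ∀ n, Finite (Y n))
      (_ : ∀ n, DiscreteTopology (Y n)) (f : ∀ n : ℕ, Y (n + 1) → Y n),
      (∀ n, Continuous (f n)) ∧
      Nonempty (M ≃ₜ {y : ∀ n, Y n // ∀ n, y n = f n (y (n + 1))}) := by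
  obtain ⟨e, he, hinj⟩ := exists_continuous_injective_nat_bool M
  let p : ∀ n : ℕ, M → Fin n → Bool := fun n x i => e x i
  have hp : ∀ n, Continuous (p n) := fun n =>
    continuous_pi fun i => (continuous_apply (i : ℕ)).comp he
  let f : ∀ n : ℕ, Set.range (p (n + 1)) → Set.range (p n) := fun n y =>
    ⟨fun i => y.1 i.castSucc, by
      obtain ⟨_, x, rfl⟩ := y
      exact ⟨x, rfl⟩⟩
  refine ⟨fun n => Set.range (p n), fun n => inferInstance, fun n => inferInstance,
    fun n => inferInstance, f, fun n => continuous_of_discreteTopology, ?_⟩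
  let g : M → {y : ∀ n, Set.range (p n) // ∀ n, y n = f n (y (n + 1))} := fun x =>
    ⟨fun n => ⟨p n x, x, rfl⟩, fun n => rfl⟩
  have hg : Continuous g :=
    (continuous_pi fun n => (hp n).subtype_mk _).subtype_mk _
  have hg_inj : Function.Injective g := by
    intro x y hxy
    refine hinj (funext fun n => ?_)
    have h : p (n + 1) x = p (n + 1) y :=
      congrArg Subtype.val (congrFun (congrArg Subtype.val hxy) (n + 1))
    exact congrFun h (Fin.last n)
  have hg_surj : Function.Surjective g := by
    rintro ⟨y, hy⟩
    have hclosed : ∀ n, IsClosed {x | p n x = (y n).1} := fun n =>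
      isClosed_eq (hp n) continuous_const
    obtain ⟨x, hx⟩ := IsCompact.nonempty_iInter_of_sequence_nonempty_isCompact_isClosed
      (fun n => {x | p n x = (y n).1})
      (fun n x hx => by
        have hx' : p (n + 1) x = (y (n + 1)).1 := hx
        change p n x = (y n).1
        rw [hy n]
        exact funext fun i => congrFun hx' i.castSucc)
      (fun n => (y n).2) (hclosed 0).isCompact hclosed
    exact ⟨x, Subtype.ext (funext fun n => Subtype.ext (Set.mem_iInter.1 hx n))⟩
  exact ⟨hg.homeoOfEquivCompactToT2 (f := Equiv.ofBijective g ⟨hg_inj, hg_surj⟩)⟩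
end
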